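/- Every torsionless-finite artin algebra has representation dimension at most 3. -/

import Mathlib

open CategoryTheory

universe u

section Defs
variable (Λ : Type u) [Ring Λ]

/-- A module is torsionless if it embeds into a finitely generated free
(equivalently, projective) module. -/
def Torsionless (N : Type u) [AddCommGroup N] [Module Λ N] : Prop :=
  ∃ (n : ℕ) (f : N →ₗ[Λ] (Fin n → Λ)), Function.Injective f

/-- A module is divisible if it is a quotient of a finitely generated injective module. -/
def Divisible (N : Type u) [AddCommGroup N] [Module Λ N] : Prop :=
  ∃ (Q : ModuleCat.{u} Λ), Module.Finite Λ Q ∧ Module.Injective Λ Q ∧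
    ∃ f : ↥Q →ₗ[Λ] N, Function.Surjective f

/-- An indecomposable module: nonzero, and the only idempotent endomorphisms are 0 and 1. -/
def Indec (N : Type u) [AddCommGroup N] [Module Λ N] : Prop :=
  Nontrivial N ∧ ∀ e : Module.End Λ N, e * e = e → e = 0 ∨ e = 1

/-- `N` belongs to `add M`: it is a direct summand of a finite direct sum of copies of `M`. -/
def InAdd (M : Type u) [AddCommGroup M] [Module Λ M]
    (N : Type u) [AddCommGroup N] [Module Λ N] : Prop :=
  ∃ (n : ℕ) (i : N →ₗ[Λ] (Fin n → M)) (p : (Fin n → M) →ₗ[Λ] N),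
    p.comp i = LinearMap.id

/-- `N` is cogenerated by `M`: it embeds into a finite direct sum of copies of `M`. -/
def CogenBy (M : Type u) [AddCommGroup M] [Module Λ M]
    (N : Type u) [AddCommGroup N] [Module Λ N] : Prop :=
  ∃ (n : ℕ) (f : N →ₗ[Λ] (Fin n → M)), Function.Injective f

/-- There are only finitely many isomorphism classes of indecomposable torsionless modules. -/
def TorsionlessFinite : Prop :=
  ∃ (n : ℕ) (L : Fin n → ModuleCat.{u} Λ),
    ∀ N : ModuleCat.{u} Λ, Module.Finite Λ N → Torsionless Λ N → Indec Λ N →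
      ∃ i, Nonempty (N ≃ₗ[Λ] L i)

/-- The algebra is representation-finite. -/
def RepFinite : Prop :=
  ∃ (n : ℕ) (L : Fin n → ModuleCat.{u} Λ),
    ∀ N : ModuleCat.{u} Λ, Module.Finite Λ N → Indec Λ N →
      ∃ i, Nonempty (N ≃ₗ[Λ] L i)

/-- `M` has a projective resolution of length at most `d` by finitely generated projectives. -/
def ProjDimLE : ℕ → ModuleCat.{u} Λ → Prop
  | 0, M => Module.Projective Λ M
  | (d+1), M => ∃ (P : ModuleCat.{u} Λ) (f : ↥P →ₗ[Λ] ↥M),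
      Module.Projective Λ P ∧ Module.Finite Λ P ∧ Function.Surjective f ∧
      ProjDimLE d (ModuleCat.of Λ ↥(LinearMap.ker f))

/-- The global dimension of `Λ` is at most `d`. -/
def GlobalDimLE (d : ℕ) : Prop :=
  ∀ M : ModuleCat.{u} Λ, Module.Finite Λ M → ProjDimLE Λ d M

/-- `M` is a generator-cogenerator: every finitely generated projective and every finitely
generated injective module lies in `add M`. -/
def IsGenCogen (M : Type u) [AddCommGroup M] [Module Λ M] : Prop :=
  Module.Finite Λ M ∧
  (∀ P : ModuleCat.{u} Λ, Module.Finite Λ P → Module.Projective Λ P → InAdd Λ M ↥P) ∧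
  (∀ Q : ModuleCat.{u} Λ, Module.Finite Λ Q → Module.Injective Λ Q → InAdd Λ M ↥Q)

/-- The representation dimension of `Λ` is at most `d`. -/
def RepDimLE (d : ℕ) : Prop :=
  ∃ M : ModuleCat.{u} Λ, IsGenCogen Λ ↥M ∧ GlobalDimLE (Module.End Λ ↥M) d

end Defs

section AddClosure

variable {Λ : Type u} [Ring Λ]
variable (M : Type u) [AddCommGroup M] [Module Λ M]
variable (N : Type u) [AddCommGroup N] [Module Λ N]
variable (N' : Type u) [AddCommGroup N'] [Module Λ N']

/-- The additive group of maps `N → N'` that factor through a finite direct sum of copies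
of `M`. -/
def mapsThrough : AddSubgroup (N →ₗ[Λ] N') :=
  AddSubgroup.closure {h | ∃ (f : N →ₗ[Λ] M) (g : M →ₗ[Λ] N'), h = g ∘ₗ f}

variable {M N N'}
variable {K : Type u} [AddCommGroup K] [Module Λ K]

theorem comp_mem_mapsThrough (f : N →ₗ[Λ] M) (g : M →ₗ[Λ] N') :
    g ∘ₗ f ∈ mapsThrough M N N' :=
  AddSubgroup.subset_closure ⟨f, g, rfl⟩

theorem mapsThrough_comp_left {h : N →ₗ[Λ] N'} (hh : h ∈ mapsThrough M N N')
    (a : N' →ₗ[Λ] K) : a ∘ₗ h ∈ mapsThrough M N K := by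
  induction hh using AddSubgroup.closure_induction with
  | mem x hx =>
    obtain ⟨f, g, rfl⟩ := hx
    exact comp_mem_mapsThrough f (a ∘ₗ g)
  | zero => rw [LinearMap.comp_zero]; exact zero_mem _
  | add x y _ _ hx hy => rw [LinearMap.comp_add]; exact add_mem hx hy
  | neg x _ hx => rw [LinearMap.comp_neg]; exact neg_mem hx

theorem mapsThrough_comp_right {h : N →ₗ[Λ] N'} (hh : h ∈ mapsThrough M N N')
    (a : K →ₗ[Λ] N) : h ∘ₗ a ∈ mapsThrough M K N' := by
  induction hh using AddSubgroup.closure_induction with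
  | mem x hx =>
    obtain ⟨f, g, rfl⟩ := hx
    exact comp_mem_mapsThrough (f ∘ₗ a) g
  | zero => rw [LinearMap.zero_comp]; exact zero_mem _
  | add x y _ _ hx hy => rw [LinearMap.add_comp]; exact add_mem hx hy
  | neg x _ hx => rw [LinearMap.neg_comp]; exact neg_mem hx

theorem exists_sum_of_mem_mapsThrough {h : N →ₗ[Λ] N'} (hh : h ∈ mapsThrough M N N') :
    ∃ (n : ℕ) (f : N →ₗ[Λ] (Fin n → M)) (g : (Fin n → M) →ₗ[Λ] N'), h = g ∘ₗ f := by
  induction hh using AddSubgroup.closure_induction with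
  | mem x hx =>
    obtain ⟨f, g, rfl⟩ := hx
    exact ⟨1, LinearMap.pi fun _ => f, g ∘ₗ LinearMap.proj 0, rfl⟩
  | zero => exact ⟨0, 0, 0, by simp⟩
  | add x y _ _ hx hy =>
    obtain ⟨n, f, g, rfl⟩ := hx
    obtain ⟨m, f', g', rfl⟩ := hy
    let e : (Fin (n + m) → M) ≃ₗ[Λ] ((Fin n → M) × (Fin m → M)) :=
      (LinearEquiv.funCongrLeft Λ M finSumFinEquiv).trans
        (LinearEquiv.sumArrowLequivProdArrow (Fin n) (Fin m) Λ M)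
    refine ⟨n + m, e.symm.toLinearMap ∘ₗ f.prod f', (g.coprod g') ∘ₗ e.toLinearMap, ?_⟩
    ext v
    simp
  | neg x _ hx =>
    obtain ⟨n, f, g, rfl⟩ := hx
    exact ⟨n, f, -g, by rw [LinearMap.neg_comp]⟩

theorem inAdd_iff : InAdd Λ M N ↔ (LinearMap.id : N →ₗ[Λ] N) ∈ mapsThrough M N N := by
  constructor
  · rintro ⟨n, i, p, h⟩
    have : (LinearMap.id : N →ₗ[Λ] N) = ∑ j : Fin n,
        (p ∘ₗ LinearMap.single Λ (fun _ => M) j) ∘ₗ (LinearMap.proj j ∘ₗ i) := by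
      rw [← h]
      ext v
      simp only [LinearMap.comp_apply, LinearMap.sum_apply, LinearMap.proj_apply,
        LinearMap.coe_single]
      rw [← map_sum, Finset.univ_sum_single]
    rw [this]
    exact sum_mem fun j _ => comp_mem_mapsThrough _ _
  · intro h
    obtain ⟨n, f, g, hfg⟩ := exists_sum_of_mem_mapsThrough h
    exact ⟨n, f, g, hfg.symm⟩

theorem InAdd.mem_mapsThrough (h : InAdd Λ M N) (f : K →ₗ[Λ] N) (g : N →ₗ[Λ] N') :
    g ∘ₗ f ∈ mapsThrough M K N' := by
  have := mapsThrough_comp_left (mapsThrough_comp_right (inAdd_iff.1 h) f) g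
  simpa using this

theorem InAdd.mapsThrough_le (h : InAdd Λ M N) (h' : K →ₗ[Λ] N')
    (hh : h' ∈ mapsThrough N K N') : h' ∈ mapsThrough M K N' := by
  refine (AddSubgroup.closure_le _).2 ?_ hh
  rintro _ ⟨f, g, rfl⟩
  exact h.mem_mapsThrough f g

theorem InAdd.trans (h : InAdd Λ M N) (h' : InAdd Λ N K) : InAdd Λ M K :=
  inAdd_iff.2 (h.mapsThrough_le _ (inAdd_iff.1 h'))

theorem InAdd.of_retract (i : N →ₗ[Λ] M) (p : M →ₗ[Λ] N) (h : p ∘ₗ i = LinearMap.id) :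
    InAdd Λ M N :=
  inAdd_iff.2 (h ▸ comp_mem_mapsThrough i p)

theorem InAdd.of_equiv (e : N ≃ₗ[Λ] M) : InAdd Λ M N :=
  .of_retract e.toLinearMap e.symm.toLinearMap (by ext; simp)

theorem InAdd.pow (n : ℕ) : InAdd Λ M (Fin n → M) :=
  ⟨n, LinearMap.id, LinearMap.id, rfl⟩

theorem InAdd.prod (h : InAdd Λ M N) (h' : InAdd Λ M K) : InAdd Λ M (N × K) := by
  have : (LinearMap.id : (N × K) →ₗ[Λ] (N × K)) =
      LinearMap.inl Λ N K ∘ₗ LinearMap.fst Λ N K +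
        LinearMap.inr Λ N K ∘ₗ LinearMap.snd Λ N K := by
    ext <;> simp
  rw [inAdd_iff, this]
  exact add_mem (h.mem_mapsThrough _ _) (h'.mem_mapsThrough _ _)

theorem InAdd.fst : InAdd Λ (M × N) M :=
  .of_retract (LinearMap.inl Λ M N) (LinearMap.fst Λ M N) (by ext; simp)

theorem InAdd.snd : InAdd Λ (M × N) N :=
  .of_retract (LinearMap.inr Λ M N) (LinearMap.snd Λ M N) (by ext; simp)

/-- An artinian module whose points are separated by maps to `M` embeds in a power of `M`. -/
theorem exists_embedding_of_separated [IsArtinian Λ N]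
    (h : ∀ x : N, x ≠ 0 → ∃ f : N →ₗ[Λ] M, f x ≠ 0) :
    ∃ (n : ℕ) (f : N →ₗ[Λ] (Fin n → M)), Function.Injective f := by
  let S : Set (Submodule Λ N) :=
    {A | ∃ (n : ℕ) (f : N →ₗ[Λ] (Fin n → M)), LinearMap.ker f = A}
  obtain ⟨A, ⟨n, f, hf⟩, hA⟩ := IsArtinian.set_has_minimal S ⟨_, 0, 0, rfl⟩
  refine ⟨n, f, LinearMap.ker_eq_bot.1 ?_⟩
  by_contra hne
  obtain ⟨x, hx, hx0⟩ := Submodule.exists_mem_ne_zero_of_ne_bot hne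
  obtain ⟨g, hg⟩ := h x hx0
  let F : N →ₗ[Λ] (Fin (n + 1) → M) := LinearMap.pi (Fin.cons g fun i => LinearMap.proj i ∘ₗ f)
  have hF : ∀ y, F y = 0 → g y = 0 ∧ f y = 0 := fun y hy =>
    ⟨congrFun hy 0, funext fun i => congrFun hy i.succ⟩
  refine hA (LinearMap.ker F) ⟨_, F, rfl⟩ (lt_of_le_of_ne ?_ ?_)
  · intro y hy
    rw [← hf]
    exact (hF y hy).2
  · intro heq
    rw [← hf] at heq
    rw [← heq] at hx
    exact hg (hF x hx).1

end AddClosure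

section InjectiveHull

theorem exists_maximal_disjoint {R : Type*} [Ring R] {I : Type*} [AddCommGroup I] [Module R I]
    (C₀ S : Submodule R I) (h : Disjoint C₀ S) :
    ∃ C, C₀ ≤ C ∧ Disjoint C S ∧ ∀ C', C ≤ C' → Disjoint C' S → C' = C := by
  have hub : ∀ c ⊆ {C : Submodule R I | Disjoint C S}, IsChain (· ≤ ·) c → ∀ y ∈ c,
      ∃ ub ∈ {C : Submodule R I | Disjoint C S}, ∀ z ∈ c, z ≤ ub := fun c hc hch y _ =>
    ⟨sSup c, (DirectedOn.disjoint_sSup_left hch.directedOn).2 fun b hb => hc hb,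
      fun z hz => le_sSup hz⟩
  obtain ⟨m, hm, hmax⟩ := zorn_le_nonempty₀ _ hub C₀ h
  exact ⟨m, hm, hmax.prop, fun C' h1 h2 => hmax.eq_of_ge h2 h1⟩

/-- Every module embeds as an essential submodule of an injective module. -/
theorem exists_injective_hull (R : Type u) [Ring R] (S : Type u) [AddCommGroup S] [Module R S] :
    ∃ (J : ModuleCat.{u} R) (ι : S →ₗ[R] J), Module.Injective R J ∧ Function.Injective ι ∧
      ∀ A : Submodule R J, Disjoint A (LinearMap.range ι) → A = ⊥ := by
  obtain ⟨I, hI, ι, hι⟩ : ∃ I : ModuleCat.{u} R, Module.Injective R I ∧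
      ∃ ι : S →ₗ[R] I, Function.Injective ι :=
    ⟨Injective.under (ModuleCat.of R S), Module.injective_module_of_injective_object (inj := inferInstanceAs
      (Injective (Injective.under (ModuleCat.of R S)))),
      (Injective.ι (ModuleCat.of R S)).hom, (ModuleCat.mono_iff_injective _).1 inferInstance⟩
  obtain ⟨C, -, hCS, hCmax⟩ := exists_maximal_disjoint ⊥ (LinearMap.range ι) disjoint_bot_left
  obtain ⟨E, hSE, hEC, hEmax⟩ := exists_maximal_disjoint (LinearMap.range ι) C hCS.symm
  have hinj : Function.Injective (C.mkQ ∘ₗ E.subtype) := by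
    rw [← LinearMap.ker_eq_bot, LinearMap.ker_eq_bot']
    intro e he
    have he' : (e : I) ∈ C := by simpa using he
    exact Subtype.ext (Submodule.disjoint_def.1 hEC e e.2 he')
  obtain ⟨h, hh⟩ := Module.Injective.out (C.mkQ ∘ₗ E.subtype) hinj E.subtype
  replace hh : ∀ e ∈ E, h (C.mkQ e) = e := fun e he => hh ⟨e, he⟩
  have hpre : (C.comap (h ∘ₗ C.mkQ)) = C := by
    apply hCmax
    · intro c hc
      have : C.mkQ c = 0 := by simpa using hc
      simp only [Submodule.mem_comap, LinearMap.comp_apply, this, map_zero, zero_mem]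
    · refine Submodule.disjoint_def.2 fun x hx hxS => ?_
      have hx' : h (C.mkQ x) ∈ C := hx
      rw [hh x (hSE hxS)] at hx'
      exact Submodule.disjoint_def.1 hCS x hx' hxS
  have hrange : LinearMap.range (h ∘ₗ C.mkQ) = E := by
    apply hEmax
    · intro e he
      exact ⟨e, hh e he⟩
    · refine Submodule.disjoint_def.2 ?_
      rintro _ ⟨y, rfl⟩ hy
      have hy' : y ∈ C := hpre ▸ (show y ∈ C.comap (h ∘ₗ C.mkQ) from hy)
      have : C.mkQ y = 0 := by simpa using hy'
      simp only [LinearMap.comp_apply, this, map_zero]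
  let r : I →ₗ[R] E := (h ∘ₗ C.mkQ).codRestrict E fun x => hrange ▸ ⟨x, rfl⟩
  have hr : ∀ e : E, r e = e := fun e => Subtype.ext (hh e e.2)
  refine ⟨ModuleCat.of R E, ι.codRestrict E fun x => hSE ⟨x, rfl⟩, ⟨?_⟩, ?_, ?_⟩
  · intro X Y _ _ _ _ f hf g
    obtain ⟨g', hg'⟩ := Module.Injective.out f hf (E.subtype ∘ₗ g)
    refine ⟨r ∘ₗ g', fun x => ?_⟩
    have := hg' x
    rw [LinearMap.comp_apply, this]
    exact hr (g x)
  · intro x y hxy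
    exact hι (congrArg Subtype.val hxy)
  · intro A hA
    have hle : A.map E.subtype ⊔ C = C := by
      apply hCmax _ le_sup_right
      refine Submodule.disjoint_def.2 fun x hx hxS => ?_
      obtain ⟨_, ⟨a, ha, rfl⟩, c, hc, rfl⟩ := Submodule.mem_sup.1 hx
      have hcE : c ∈ E := by
        have := E.sub_mem (hSE hxS) a.2
        simpa using this
      obtain rfl : c = 0 := Submodule.disjoint_def.1 hEC c hcE hc
      obtain ⟨s, hs⟩ := hxS
      have : a = 0 := Submodule.disjoint_def.1 hA a ha ⟨s, Subtype.ext (by simpa using hs)⟩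
      simp [this]
    refine (Submodule.eq_bot_iff _).2 fun a ha => ?_
    have haC : (a : I) ∈ C := hle ▸ Submodule.mem_sup_left ⟨a, ha, rfl⟩
    exact Subtype.ext (Submodule.disjoint_def.1 hEC a a.2 haC)

end InjectiveHull

section Duality

variable {k : Type u} [CommRing k]

theorem length_hom_le_of_exact {J N₁ N₂ N₃ : Type u} [AddCommGroup J] [Module k J]
    [AddCommGroup N₁] [Module k N₁] [AddCommGroup N₂] [Module k N₂]
    [AddCommGroup N₃] [Module k N₃] {f : N₁ →ₗ[k] N₂} {g : N₂ →ₗ[k] N₃}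
    (hg : Function.Surjective g) (hfg : Function.Exact f g) :
    Module.length k (N₂ →ₗ[k] J) ≤
      Module.length k (N₃ →ₗ[k] J) + Module.length k (N₁ →ₗ[k] J) := by
  let F : (N₂ →ₗ[k] J) →ₗ[k] (N₁ →ₗ[k] J) := LinearMap.lcomp k J f
  let G : (N₃ →ₗ[k] J) →ₗ[k] (N₂ →ₗ[k] J) := LinearMap.lcomp k J g
  have hker : LinearMap.ker F ≤ LinearMap.range G := by
    intro h hh
    have hle : LinearMap.ker g ≤ LinearMap.ker h := by
      intro x hx
      obtain ⟨y, rfl⟩ := (hfg x).1 hx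
      exact LinearMap.congr_fun hh y
    refine ⟨(LinearMap.ker g).liftQ h hle ∘ₗ
      (g.quotKerEquivOfSurjective hg).symm.toLinearMap, LinearMap.ext fun x => ?_⟩
    have : (g.quotKerEquivOfSurjective hg).symm (g x) = (LinearMap.ker g).mkQ x := by
      rw [LinearEquiv.symm_apply_eq]
      rfl
    simp only [G, LinearMap.lcomp_apply, LinearMap.comp_apply, LinearEquiv.coe_coe, this]
    rfl
  rw [Module.length_eq_add_of_exact (LinearMap.ker F).subtype F.rangeRestrict
    (Submodule.subtype_injective _) F.surjective_rangeRestrict (by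
      rw [LinearMap.exact_iff, LinearMap.ker_rangeRestrict, Submodule.range_subtype])]
  refine add_le_add ?_ (Module.length_le_of_injective _ (Submodule.subtype_injective _))
  exact (Module.length_le_of_injective _ (Submodule.inclusion_injective hker)).trans
    (Module.length_le_of_surjective _ G.surjective_rangeRestrict)

/-- An artinian commutative ring has an injective cogenerator that does not increase lengths
of dual modules. -/
theorem exists_dualizing_module (k : Type u) [CommRing k] [IsArtinianRing k] :
    ∃ J : ModuleCat.{u} k, Module.Injective k J ∧
      (∀ (X : Type u) [AddCommGroup X] [Module k X] (x : X), x ≠ 0 →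
        ∃ f : X →ₗ[k] J, f x ≠ 0) ∧
      ∀ (X : Type u) [AddCommGroup X] [Module k X], Module.Finite k X →
        Module.length k (X →ₗ[k] J) ≤ Module.length k X := by
  classical
  let S : Type u := ∀ m : MaximalSpectrum k, k ⧸ m.asIdeal
  obtain ⟨J, ι, hJ, hι, hess⟩ := exists_injective_hull k S
  refine ⟨J, hJ, ?_, ?_⟩
  · intro X _ _ x hx
    let t : k →ₗ[k] X := LinearMap.toSpanSingleton k X x
    have ht : LinearMap.ker t ≠ ⊤ := by
      intro h
      have : (1 : k) ∈ LinearMap.ker t := h ▸ Submodule.mem_top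
      exact hx (by simpa [t] using this)
    obtain ⟨m, hm, hle⟩ := Ideal.exists_le_maximal (LinearMap.ker t) ht
    let p : MaximalSpectrum k := ⟨m, hm⟩
    let q : (k ⧸ LinearMap.ker t) →ₗ[k] k ⧸ p.asIdeal := Submodule.factor hle
    obtain ⟨h, hh⟩ := Module.Injective.out ((LinearMap.ker t).liftQ t le_rfl)
      (LinearMap.ker_eq_bot.1 (Submodule.ker_liftQ_eq_bot _ _ _ le_rfl))
      (ι ∘ₗ LinearMap.single k (fun m : MaximalSpectrum k => k ⧸ m.asIdeal) p ∘ₗ q)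
    refine ⟨h, fun h0 => ?_⟩
    have h1 := hh (Submodule.Quotient.mk 1)
    have h2 : (LinearMap.ker t).liftQ t le_rfl (Submodule.Quotient.mk 1) = x :=
      (Submodule.liftQ_apply _ _ _).trans (LinearMap.toSpanSingleton_apply_one k X x)
    rw [h2, h0] at h1
    have h3 := hι (h1.symm.trans (map_zero ι).symm)
    have h4 : (Ideal.Quotient.mk m 1) = 0 :=
      (Pi.single_eq_same (M := fun m : MaximalSpectrum k => k ⧸ m.asIdeal) p
        (q (Submodule.Quotient.mk 1))).symm.trans (congrFun h3 p)
    exact hm.ne_top ((Ideal.eq_top_iff_one _).2 (Ideal.Quotient.eq_zero_iff_mem.1 h4))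
  · intro X _ _ hX
    induction hX using IsNoetherianRing.induction_on_isQuotientEquivQuotientPrime k with
    | subsingleton N =>
      have : Subsingleton (N →ₗ[k] J) := ⟨fun f g => LinearMap.ext fun x => by
        rw [Subsingleton.elim x 0, map_zero, map_zero]⟩
      simp [Module.length_eq_zero]
    | quotient N p e =>
      let m : MaximalSpectrum k := ⟨p.1, IsArtinianRing.isMaximal_of_isPrime p.1⟩
      let σ : (k ⧸ p.1) →ₗ[k] J :=
        ι ∘ₗ LinearMap.single k (fun m : MaximalSpectrum k => k ⧸ m.asIdeal) m
      have key : ∀ j : J, (∀ r ∈ p.1, r • j = 0) → j ∈ LinearMap.range σ := by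
        intro j hj
        by_cases hj0 : j = 0
        · exact hj0 ▸ zero_mem _
        have hnd : ¬ Disjoint (Submodule.span k {j}) (LinearMap.range ι) := fun hd =>
          hj0 (Submodule.span_singleton_eq_bot.1 (hess _ hd))
        rw [Submodule.disjoint_def] at hnd
        push Not at hnd
        obtain ⟨_, hy, ⟨s, rfl⟩, hs0⟩ := hnd
        obtain ⟨r, hr⟩ := Submodule.mem_span_singleton.1 hy
        have hrp : r ∉ p.1 := fun h => hs0 (hr ▸ hj r h)
        obtain ⟨t, i, hi, hti⟩ := m.isMaximal.exists_inv hrp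
        have hjs : j = ι (t • s) := by
          rw [map_smul, ← hr, smul_smul]
          conv_lhs => rw [← one_smul k j, ← hti, add_smul, hj i hi, add_zero]
        refine ⟨(t • s) m, ?_⟩
        rw [hjs]
        refine congrArg ι ?_
        funext m'
        by_cases hm : m' = m
        · subst hm
          exact Pi.single_eq_same (M := fun m : MaximalSpectrum k => k ⧸ m.asIdeal) m _
        · rw [LinearMap.single_apply, Pi.single_eq_of_ne hm]
          obtain ⟨r', hr', hr'm⟩ : ∃ r' ∈ p.1, r' ∉ m'.asIdeal := by
            by_contra hcon
            push Not at hcon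
            exact hm (MaximalSpectrum.ext (m.isMaximal.eq_of_le m'.isMaximal.ne_top hcon).symm)
          have hz : r' • (t • s) = 0 := hι (by rw [map_smul, ← hjs, hj r' hr', map_zero])
          have hz' := congrFun hz m'
          obtain ⟨c, hc⟩ := Ideal.Quotient.mk_surjective ((t • s) m')
          rw [← hc]
          have hz2 : Ideal.Quotient.mk m'.asIdeal (r' * c) = 0 := by
            rw [map_mul, hc]
            exact hz'
          exact (Ideal.Quotient.eq_zero_iff_mem.2 ((m'.isMaximal.isPrime.mem_or_mem
            (Ideal.Quotient.eq_zero_iff_mem.1 hz2)).resolve_left hr'm)).symm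
      let ev : (N →ₗ[k] J) →ₗ[k] LinearMap.range σ :=
        (LinearMap.applyₗ (e.symm (Ideal.Quotient.mk p.1 1))).codRestrict _ (by
          intro f
          refine key _ fun r hr => ?_
          have : r • e.symm (Ideal.Quotient.mk p.1 1) = 0 := by
            rw [← map_smul, ← map_zero e.symm]
            congr 1
            rw [← Ideal.Quotient.eq_zero_iff_mem] at hr
            rw [Algebra.smul_def, Ideal.Quotient.algebraMap_eq, hr, zero_mul]
          rw [LinearMap.applyₗ_apply_apply, ← map_smul, this, map_zero])
      have hev : Function.Injective ev := by
        rw [← LinearMap.ker_eq_bot, LinearMap.ker_eq_bot']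
        intro f hf
        have hf' : f (e.symm (Ideal.Quotient.mk p.1 1)) = 0 := congrArg Subtype.val hf
        refine LinearMap.ext fun x => ?_
        obtain ⟨c, hc⟩ := Ideal.Quotient.mk_surjective (e x)
        have : x = c • e.symm (Ideal.Quotient.mk p.1 1) := by
          rw [← map_smul, LinearEquiv.eq_symm_apply, ← hc, Algebra.smul_def,
            Ideal.Quotient.algebraMap_eq, map_one, mul_one]
        rw [this, map_smul, hf', smul_zero, LinearMap.zero_apply]
      rw [e.length_eq]
      exact (Module.length_le_of_injective ev hev).trans
        (Module.length_le_of_surjective _ σ.surjective_rangeRestrict)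
    | exact N₁ N₂ N₃ f g hf hg hfg h₁ h₃ =>
      rw [Module.length_eq_add_of_exact f g hf hg hfg, add_comm]
      exact (length_hom_le_of_exact hg hfg).trans (add_le_add h₃ h₁)

theorem finite_of_length_ne_top {R X : Type*} [Ring R] [AddCommGroup X] [Module R X]
    (h : Module.length R X ≠ ⊤) : Module.Finite R X := by
  have := isFiniteLength_iff_isNoetherian_isArtinian.1 (Module.length_ne_top_iff.1 h)
  have := this.1
  infer_instance

theorem length_ne_top_of_finite [IsArtinianRing k] (X : Type*) [AddCommGroup X] [Module k X]
    [Module.Finite k X] : Module.length k X ≠ ⊤ :=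
  Module.length_ne_top

/-- Biduality: linear functionals on the dual are evaluations. -/
theorem exists_eq_eval [IsArtinianRing k] {J : Type u} [AddCommGroup J] [Module k J]
    (hsep : ∀ (X : Type u) [AddCommGroup X] [Module k X] (x : X), x ≠ 0 →
        ∃ f : X →ₗ[k] J, f x ≠ 0)
    (hlen : ∀ (X : Type u) [AddCommGroup X] [Module k X], Module.Finite k X →
        Module.length k (X →ₗ[k] J) ≤ Module.length k X)
    (X : Type u) [AddCommGroup X] [Module k X] [Module.Finite k X]
    (φ : (X →ₗ[k] J) →ₗ[k] J) : ∃ x : X, ∀ f, φ f = f x := by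
  let ev : X →ₗ[k] ((X →ₗ[k] J) →ₗ[k] J) := LinearMap.applyₗ
  have hev : Function.Injective ev := by
    rw [← LinearMap.ker_eq_bot, LinearMap.ker_eq_bot']
    intro x hx
    by_contra hx0
    obtain ⟨f, hf⟩ := hsep X x hx0
    exact hf (LinearMap.congr_fun hx f)
  have hfin : Module.Finite k (X →ₗ[k] J) := finite_of_length_ne_top
    (ne_top_of_le_ne_top (length_ne_top_of_finite X) (hlen X inferInstance))
  have hle : Module.length k ((X →ₗ[k] J) →ₗ[k] J) ≤ Module.length k X :=
    (hlen _ hfin).trans (hlen X inferInstance)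
  have hfin' : Module.Finite k ((X →ₗ[k] J) →ₗ[k] J) := finite_of_length_ne_top
    (ne_top_of_le_ne_top (length_ne_top_of_finite X) hle)
  have htop : LinearMap.range ev = ⊤ := by
    by_contra hne
    have h1 := Submodule.length_lt hne
    rw [← (LinearEquiv.ofInjective ev hev).length_eq] at h1
    exact absurd hle (not_le.2 h1)
  obtain ⟨x, hx⟩ := LinearMap.range_eq_top.1 htop φ
  exact ⟨x, fun f => (LinearMap.congr_fun hx f).symm⟩

end Duality

section Coinduced

variable (k : Type u) [CommRing k] (Λ : Type u) [Ring Λ] [Algebra k Λ]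
  (J : Type u) [AddCommGroup J] [Module k J]

/-- The `k`-dual of `Λ` with values in `J`, as a left `Λ`-module. -/
def Coinduced : Type u := Λ →ₗ[k] J

namespace Coinduced

instance : AddCommGroup (Coinduced k Λ J) := inferInstanceAs (AddCommGroup (Λ →ₗ[k] J))

instance : Module k (Coinduced k Λ J) := inferInstanceAs (Module k (Λ →ₗ[k] J))

variable {k Λ J}

/-- The underlying `k`-linear map. -/
def toHom : Coinduced k Λ J ≃ₗ[k] (Λ →ₗ[k] J) := LinearEquiv.refl k _

theorem ext {f g : Coinduced k Λ J} (h : ∀ x, toHom f x = toHom g x) : f = g :=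
  toHom.injective (LinearMap.ext h)

instance : SMul Λ (Coinduced k Λ J) where
  smul a f := toHom.symm (toHom f ∘ₗ LinearMap.mulRight k a)

theorem smul_apply (a : Λ) (f : Coinduced k Λ J) (x : Λ) :
    toHom (a • f) x = toHom f (x * a) := rfl

instance : Module Λ (Coinduced k Λ J) where
  one_smul f := ext fun x => by rw [smul_apply, mul_one]
  mul_smul a b f := ext fun x => by simp only [smul_apply, mul_assoc]
  smul_zero a := ext fun x => by simp only [smul_apply, map_zero, LinearMap.zero_apply]
  smul_add a f g := ext fun x => by simp only [smul_apply, map_add, LinearMap.add_apply]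
  add_smul a b f := ext fun x => by
    simp only [smul_apply, map_add, LinearMap.add_apply, mul_add]
  zero_smul f := ext fun x => by simp only [smul_apply, mul_zero, map_zero, LinearMap.zero_apply]

instance : IsScalarTower k Λ (Coinduced k Λ J) where
  smul_assoc c a f := ext fun x => by
    simp only [smul_apply, map_smul, LinearMap.smul_apply, mul_smul_comm]

/-- The `Λ`-linear map into the coinduced module that corresponds to a `k`-linear map. -/
def lift {X : Type u} [AddCommGroup X] [Module Λ X] [Module k X] [IsScalarTower k Λ X]
    (f : X →ₗ[k] J) : X →ₗ[Λ] Coinduced k Λ J where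
  toFun x := toHom.symm (f ∘ₗ (LinearMap.toSpanSingleton Λ X x).restrictScalars k)
  map_add' x y := ext fun a => by simp
  map_smul' a x := ext fun b => by
    rw [RingHom.id_apply, smul_apply]
    simp [mul_smul]

theorem lift_apply {X : Type u} [AddCommGroup X] [Module Λ X] [Module k X] [IsScalarTower k Λ X]
    (f : X →ₗ[k] J) (x : X) (a : Λ) : toHom (lift f x : Coinduced k Λ J) a = f (a • x) := rfl

/-- The endomorphism of the coinduced module given by right multiplication. -/
def rightMul : Λ →+ Module.End Λ (Coinduced k Λ J) where
  toFun a :=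
    { toFun := fun f => toHom.symm (toHom f ∘ₗ LinearMap.mulLeft k a)
      map_add' := fun f g => ext fun x => by simp
      map_smul' := fun b f => ext fun x => by
        rw [RingHom.id_apply, smul_apply]
        simp [smul_apply, mul_assoc] }
  map_zero' := LinearMap.ext fun f => ext fun x => by simp
  map_add' a b := LinearMap.ext fun f => ext fun x => by simp [add_mul]

theorem rightMul_apply (a : Λ) (f : Coinduced k Λ J) (x : Λ) :
    toHom (rightMul a f) x = toHom f (a * x) := rfl

end Coinduced

/-- An artin algebra has a finitely generated injective cogenerator whose endomorphism ring
is the opposite of the algebra. -/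
theorem exists_injective_cogenerator [IsArtinianRing k] [Module.Finite k Λ] :
    ∃ W : ModuleCat.{u} Λ, Module.Finite Λ W ∧ Module.Injective Λ W ∧
      (∀ (X : Type u) [AddCommGroup X] [Module Λ X] (x : X), x ≠ 0 →
        ∃ f : X →ₗ[Λ] W, f x ≠ 0) ∧
      ∃ ρ : Λ ≃+ Module.End Λ W, ∀ a b, ρ (a * b) = ρ b ∘ₗ ρ a := by
  obtain ⟨J, hJ, hsep, hlen⟩ := exists_dualizing_module k
  refine ⟨ModuleCat.of Λ (Coinduced k Λ J), ?_, ⟨?_⟩, ?_, ?_⟩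
  · have h : Module.Finite k (Λ →ₗ[k] J) := finite_of_length_ne_top
      (ne_top_of_le_ne_top (length_ne_top_of_finite Λ) (hlen Λ inferInstance))
    have : Module.Finite k (Coinduced k Λ J) := h
    exact Module.Finite.of_restrictScalars_finite k Λ (Coinduced k Λ J)
  · intro X Y _ _ _ _ f hf g
    let _ := Module.compHom X (algebraMap k Λ)
    let _ := Module.compHom Y (algebraMap k Λ)
    have : IsScalarTower k Λ X := .of_algebraMap_smul fun _ _ => rfl
    have : IsScalarTower k Λ Y := .of_algebraMap_smul fun _ _ => rfl
    change X →ₗ[Λ] Coinduced k Λ J at g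
    let g₀ : X →ₗ[k] J := LinearMap.applyₗ (1 : Λ) ∘ₗ
      Coinduced.toHom.toLinearMap ∘ₗ g.restrictScalars k
    obtain ⟨h, hh⟩ := Module.Injective.out (f.restrictScalars k) hf g₀
    refine ⟨Coinduced.lift h, fun x => Coinduced.ext fun a => ?_⟩
    rw [Coinduced.lift_apply, ← map_smul]
    refine (hh (a • x)).trans ?_
    simp [g₀, Coinduced.smul_apply]
  · intro X _ _ x hx
    let _ := Module.compHom X (algebraMap k Λ)
    have : IsScalarTower k Λ X := .of_algebraMap_smul fun _ _ => rfl
    obtain ⟨f, hf⟩ := hsep X x hx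
    refine ⟨Coinduced.lift f, fun h => hf ?_⟩
    have := Coinduced.lift_apply f x (1 : Λ)
    rw [one_smul] at this
    rw [← this, h, map_zero, LinearMap.zero_apply]
  · refine ⟨AddEquiv.ofBijective (Coinduced.rightMul (k := k) (Λ := Λ) (J := J)) ⟨?_, ?_⟩, ?_⟩
    · rw [injective_iff_map_eq_zero]
      intro a ha
      by_contra ha0
      obtain ⟨f, hf⟩ := hsep Λ a ha0
      have := Coinduced.rightMul_apply a (Coinduced.toHom.symm f) 1
      rw [ha, mul_one] at this
      exact hf (this.symm.trans (by simp))
    · intro φ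
      let φ₁ : (Λ →ₗ[k] J) →ₗ[k] J := LinearMap.applyₗ (1 : Λ) ∘ₗ
        Coinduced.toHom.toLinearMap ∘ₗ φ.restrictScalars k ∘ₗ Coinduced.toHom.symm.toLinearMap
      obtain ⟨a, ha⟩ := exists_eq_eval hsep hlen Λ φ₁
      refine ⟨a, LinearMap.ext fun f => Coinduced.ext fun x => ?_⟩
      have h1 := ha (Coinduced.toHom (x • f))
      rw [Coinduced.smul_apply] at h1
      rw [Coinduced.rightMul_apply, ← h1]
      simp [φ₁, Coinduced.smul_apply]
    · intro a b
      refine LinearMap.ext fun f => Coinduced.ext fun x => ?_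
      exact congrArg (Coinduced.toHom f) (mul_assoc a b x)

end Coinduced

section Torsionless

variable {Λ : Type u} [Ring Λ]

theorem Torsionless.of_injective {N N' : Type u} [AddCommGroup N] [Module Λ N]
    [AddCommGroup N'] [Module Λ N'] (h : Torsionless Λ N) (f : N' →ₗ[Λ] N)
    (hf : Function.Injective f) : Torsionless Λ N' := by
  obtain ⟨n, g, hg⟩ := h
  exact ⟨n, g ∘ₗ f, hg.comp hf⟩

theorem Torsionless.exists_ne_zero {N : Type u} [AddCommGroup N] [Module Λ N]
    (h : Torsionless Λ N) {x : N} (hx : x ≠ 0) : ∃ f : N →ₗ[Λ] Λ, f x ≠ 0 := by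
  obtain ⟨n, g, hg⟩ := h
  have : g x ≠ 0 := fun h0 => hx (hg (h0.trans (map_zero g).symm))
  obtain ⟨i, hi⟩ := Function.ne_iff.1 this
  exact ⟨LinearMap.proj i ∘ₗ g, hi⟩

theorem inAdd_of_forall_indec {T N : Type u} [AddCommGroup T] [Module Λ T]
    [AddCommGroup N] [Module Λ N] [IsArtinian Λ N]
    (h : ∀ A : Submodule Λ N, Indec Λ A → InAdd Λ T A) : InAdd Λ T N := by
  have key : ∀ A : Submodule Λ N, (LinearMap.id : A →ₗ[Λ] A) ∈ mapsThrough T A A := by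
    intro A
    induction A using WellFoundedLT.induction with
    | ind A ih =>
      by_cases hA : Indec Λ A
      · exact inAdd_iff.1 (h A hA)
      have idem : ∀ e : Module.End Λ A, e * e = e → e ≠ 1 → e ∈ mapsThrough T A A := by
        intro e he he1
        let B : Submodule Λ N := (LinearMap.range e).map A.subtype
        have hBA : B ≤ A := by
          rintro _ ⟨y, -, rfl⟩
          exact y.2
        have hlt : B < A := by
          refine lt_of_le_of_ne hBA fun hBe => he1 (LinearMap.ext fun x => ?_)
          have hx : (x : N) ∈ B := hBe.ge x.2
          obtain ⟨_, ⟨z, rfl⟩, hz⟩ := hx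
          have hz' : e z = x := Subtype.ext hz
          rw [← hz']
          exact LinearMap.congr_fun he z
        let p : A →ₗ[Λ] B := (A.subtype ∘ₗ e).codRestrict B fun x => ⟨e x, ⟨x, rfl⟩, rfl⟩
        have := mapsThrough_comp_left (mapsThrough_comp_right (ih B hlt) p)
          (Submodule.inclusion hBA)
        exact this
      by_cases hs : Subsingleton A
      · rw [Subsingleton.elim (LinearMap.id : A →ₗ[Λ] A) 0]
        exact zero_mem _
      have hnt : Nontrivial A := not_subsingleton_iff_nontrivial.1 hs
      obtain ⟨e, he, he0, he1⟩ : ∃ e : Module.End Λ A, e * e = e ∧ e ≠ 0 ∧ e ≠ 1 := by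
        by_contra hcon
        push Not at hcon
        refine hA ⟨hnt, fun e he => ?_⟩
        by_cases h0 : e = 0
        · exact Or.inl h0
        · exact Or.inr (hcon e he h0)
      have h1 := idem e he he1
      have h2 := idem (1 - e) (by rw [mul_sub, sub_mul, sub_mul, he]; simp)
        (fun h => he0 (by simpa using h))
      have h3 := add_mem h1 h2
      rwa [add_sub_cancel] at h3
  exact (inAdd_iff.2 (key ⊤)).trans (.of_equiv (Submodule.topEquiv (R := Λ) (M := N)).symm)

/-- If `Λ` is torsionless-finite, then the finitely generated torsionless modules form `add T`
for a single module `T`. -/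
theorem TorsionlessFinite.exists_additive_generator [IsArtinianRing Λ] [IsNoetherianRing Λ]
    (hTF : TorsionlessFinite Λ) :
    ∃ T : ModuleCat.{u} Λ, Module.Finite Λ T ∧ Torsionless Λ T ∧
      ∀ (N : Type u) [AddCommGroup N] [Module Λ N], Module.Finite Λ N → Torsionless Λ N →
        InAdd Λ T N := by
  classical
  obtain ⟨n, L, hL⟩ := hTF
  let S := {i : Fin n // Module.Finite Λ (L i) ∧ Torsionless Λ (L i)}
  have hfin : ∀ i : S, Module.Finite Λ (L i.1) := fun i => i.2.1
  have hT : Module.Finite Λ (∀ i : S, L i.1) := inferInstance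
  refine ⟨ModuleCat.of Λ (∀ i : S, L i.1), hT, ?_, ?_⟩
  · have : IsArtinian Λ (∀ i : S, L i.1) := inferInstance
    refine exists_embedding_of_separated fun x hx => ?_
    obtain ⟨i, hi⟩ := Function.ne_iff.1 hx
    obtain ⟨f, hf⟩ := i.2.2.exists_ne_zero hi
    exact ⟨f ∘ₗ LinearMap.proj i, hf⟩
  · intro N _ _ hN hNT
    refine inAdd_of_forall_indec fun A hA => ?_
    have hAT : Torsionless Λ A := hNT.of_injective A.subtype A.subtype_injective
    have hAF : Module.Finite Λ A := inferInstance
    obtain ⟨i, ⟨e⟩⟩ := hL (ModuleCat.of Λ A) hAF hAT hA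
    change A ≃ₗ[Λ] L i at e
    let j : S := ⟨i, Module.Finite.equiv e,
      hAT.of_injective e.symm.toLinearMap e.symm.injective⟩
    refine InAdd.of_retract
      (LinearMap.single Λ (fun i : S => L i.1) j ∘ₗ e.toLinearMap)
      (e.symm.toLinearMap ∘ₗ LinearMap.proj (φ := fun i : S => L i.1) j) ?_
    refine LinearMap.ext fun x => ?_
    refine (congrArg e.symm (Pi.single_eq_same (M := fun i : S => L i.1) j (e x))).trans ?_
    exact e.symm_apply_apply x

end Torsionless

section Divisible

variable {Λ : Type u} [Ring Λ] {W : Type u} [AddCommGroup W] [Module Λ W]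

/-- The map `W → W ^ n` attached to an element of `Λ ^ n` by an identification of `Λ` with the
endomorphisms of `W`. -/
def rowMap (ρ : Λ ≃+ Module.End Λ W) {n : ℕ} : (Fin n → Λ) →+ (W →ₗ[Λ] (Fin n → W)) where
  toFun p := LinearMap.pi fun i => ρ (p i)
  map_zero' := by ext; simp
  map_add' p q := by ext; simp

theorem rowMap_apply (ρ : Λ ≃+ Module.End Λ W) {n : ℕ} (p : Fin n → Λ) (w : W) (i : Fin n) :
    rowMap ρ p w i = ρ (p i) w := rfl

theorem exists_eq_rowMap (ρ : Λ ≃+ Module.End Λ W) {n : ℕ} (f : W →ₗ[Λ] (Fin n → W)) :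
    ∃ p, f = rowMap ρ p := by
  refine ⟨fun i => ρ.symm (LinearMap.proj i ∘ₗ f), LinearMap.ext fun w => funext fun i => ?_⟩
  rw [rowMap_apply, ρ.apply_symm_apply]
  rfl

/-- The map `W ^ n → W ^ m` induced by a map `Λ ^ n → Λ ^ m`. -/
def matMap (ρ : Λ ≃+ Module.End Λ W) {n m : ℕ} :
    ((Fin n → Λ) →ₗ[Λ] (Fin m → Λ)) →+ ((Fin n → W) →ₗ[Λ] (Fin m → W)) where
  toFun a := ∑ i, rowMap ρ (a (Pi.single i 1)) ∘ₗ LinearMap.proj i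
  map_zero' := by simp
  map_add' a b := by simp [LinearMap.add_comp, Finset.sum_add_distrib]

theorem matMap_apply (ρ : Λ ≃+ Module.End Λ W) {n m : ℕ}
    (a : (Fin n → Λ) →ₗ[Λ] (Fin m → Λ)) (w : Fin n → W) :
    matMap ρ a w = ∑ i, rowMap ρ (a (Pi.single i 1)) (w i) := by
  simp [matMap]

variable {ρ : Λ ≃+ Module.End Λ W} (hρ : ∀ a b, ρ (a * b) = ρ b ∘ₗ ρ a)
include hρ

theorem map_one_of_antimultiplicative : ρ 1 = LinearMap.id := by
  have h : ∀ f : Module.End Λ W, ρ 1 ∘ₗ f = f := fun f => by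
    obtain ⟨a, rfl⟩ := ρ.surjective f
    rw [← hρ, mul_one]
  exact h LinearMap.id

theorem rowMap_smul {n : ℕ} (c : Λ) (p : Fin n → Λ) :
    rowMap ρ (c • p) = rowMap ρ p ∘ₗ ρ c := by
  refine LinearMap.ext fun w => funext fun i => ?_
  rw [rowMap_apply, Pi.smul_apply, smul_eq_mul, hρ]
  rfl

theorem matMap_rowMap {n m : ℕ} (a : (Fin n → Λ) →ₗ[Λ] (Fin m → Λ)) (p : Fin n → Λ) :
    matMap ρ a ∘ₗ rowMap ρ p = rowMap ρ (a p) := by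
  refine LinearMap.ext fun w => ?_
  rw [LinearMap.comp_apply, matMap_apply]
  conv_rhs => rw [pi_eq_sum_univ' p, map_sum, map_sum, LinearMap.sum_apply]
  refine Finset.sum_congr rfl fun i _ => ?_
  rw [map_smul, rowMap_smul hρ]
  rfl

theorem matMap_comp {n m l : ℕ} (b : (Fin m → Λ) →ₗ[Λ] (Fin l → Λ))
    (a : (Fin n → Λ) →ₗ[Λ] (Fin m → Λ)) :
    matMap ρ (b ∘ₗ a) = matMap ρ b ∘ₗ matMap ρ a := by
  refine LinearMap.ext fun w => ?_
  rw [LinearMap.comp_apply, matMap_apply ρ (b ∘ₗ a), matMap_apply ρ a, map_sum]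
  refine Finset.sum_congr rfl fun i _ => ?_
  rw [LinearMap.comp_apply, ← matMap_rowMap hρ b]
  rfl

theorem matMap_id {n : ℕ} :
    matMap ρ (LinearMap.id : (Fin n → Λ) →ₗ[Λ] (Fin n → Λ)) = LinearMap.id := by
  refine LinearMap.ext fun w => ?_
  rw [matMap_apply]
  conv_rhs => rw [LinearMap.id_apply, ← Finset.univ_sum_single w]
  refine Finset.sum_congr rfl fun i _ => funext fun j => ?_
  rw [rowMap_apply, LinearMap.id_apply]
  by_cases h : j = i
  · subst h
    rw [Pi.single_eq_same, Pi.single_eq_same, map_one_of_antimultiplicative hρ]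
    rfl
  · rw [Pi.single_eq_of_ne h, Pi.single_eq_of_ne h, map_zero]
    rfl

omit hρ in
variable (ρ) in
/-- The submodule of `W ^ n` generated by the maps attached to the elements of `A`. -/
def rowSpan {n : ℕ} (A : Submodule Λ (Fin n → Λ)) : Submodule Λ (Fin n → W) :=
  ⨆ p : A, LinearMap.range (rowMap ρ p.1)

omit hρ in
theorem rowMap_mem_rowSpan {n : ℕ} {A : Submodule Λ (Fin n → Λ)} {p : Fin n → Λ} (hp : p ∈ A)
    (w : W) : rowMap ρ p w ∈ rowSpan ρ A :=
  Submodule.mem_iSup_of_mem (⟨p, hp⟩ : A) ⟨w, rfl⟩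

theorem matMap_mem_rowSpan {n m : ℕ} {A : Submodule Λ (Fin n → Λ)}
    {B : Submodule Λ (Fin m → Λ)} {a : (Fin n → Λ) →ₗ[Λ] (Fin m → Λ)}
    (ha : ∀ p ∈ A, a p ∈ B) {w : Fin n → W} (hw : w ∈ rowSpan ρ A) :
    matMap ρ a w ∈ rowSpan ρ B := by
  have : rowSpan ρ A ≤ (rowSpan ρ B).comap (matMap ρ a) := by
    refine iSup_le fun p => ?_
    rintro _ ⟨v, rfl⟩
    have := rowMap_mem_rowSpan (ρ := ρ) (ha p p.2) v
    rwa [← matMap_rowMap hρ] at this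
  exact this hw

/-- The row span of a finitely generated submodule is a quotient of a power of `W`. -/
theorem exists_surjective_rowSpan [IsNoetherianRing Λ] {n : ℕ}
    (A : Submodule Λ (Fin n → Λ)) :
    ∃ (m : ℕ) (f : (Fin m → W) →ₗ[Λ] rowSpan ρ A), Function.Surjective f := by
  obtain ⟨m, s, hs⟩ := Submodule.fg_iff_exists_fin_generating_family.1
    (IsNoetherian.noetherian A)
  let g : (Fin m → W) →ₗ[Λ] (Fin n → W) := ∑ j, rowMap ρ (s j) ∘ₗ LinearMap.proj j
  have hgapp : ∀ v, g v = ∑ j, rowMap ρ (s j) (v j) := fun v => by simp [g]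
  have hsA : ∀ j, s j ∈ A := fun j => hs ▸ Submodule.subset_span ⟨j, rfl⟩
  have hg : ∀ v, g v ∈ rowSpan ρ A := fun v => by
    rw [hgapp]
    exact sum_mem fun j _ => rowMap_mem_rowSpan (hsA j) _
  refine ⟨m, g.codRestrict _ hg, ?_⟩
  have hle : rowSpan ρ A ≤ LinearMap.range g := by
    refine iSup_le ?_
    rintro ⟨p, hp⟩
    change LinearMap.range (rowMap ρ p) ≤ _
    rw [← hs] at hp
    induction hp using Submodule.span_induction with
    | mem x hx =>
      obtain ⟨j, rfl⟩ := hx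
      rintro _ ⟨w, rfl⟩
      refine ⟨Pi.single j w, ?_⟩
      rw [hgapp, Finset.sum_eq_single j]
      · rw [Pi.single_eq_same]
      · intro i _ hi
        rw [Pi.single_eq_of_ne hi, map_zero]
      · simp
    | zero => simp
    | add x y _ _ hx hy =>
      rintro _ ⟨w, rfl⟩
      rw [map_add, LinearMap.add_apply]
      exact add_mem (hx ⟨w, rfl⟩) (hy ⟨w, rfl⟩)
    | smul c x _ hx =>
      rintro _ ⟨w, rfl⟩
      rw [rowMap_smul hρ]
      exact hx ⟨ρ c w, rfl⟩
  rintro ⟨x, hx⟩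
  obtain ⟨v, hv⟩ := hle hx
  exact ⟨v, Subtype.ext hv⟩

/-- If `Λ ^ n / A` lies in `add (Λ ^ m / B)`, then the row span of `A` lies in `add` of the
direct sum of `W` and the row span of `B`. -/
theorem inAdd_rowSpan {n m : ℕ} {A : Submodule Λ (Fin n → Λ)} {B : Submodule Λ (Fin m → Λ)}
    (h : InAdd Λ ((Fin m → Λ) ⧸ B) ((Fin n → Λ) ⧸ A)) :
    InAdd Λ (rowSpan ρ B × W) (rowSpan ρ A) := by
  have key : ∀ z ∈ mapsThrough ((Fin m → Λ) ⧸ B) ((Fin n → Λ) ⧸ A) ((Fin n → Λ) ⧸ A),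
      ∃ c : (Fin n → Λ) →ₗ[Λ] (Fin n → Λ), A.mkQ ∘ₗ c = z ∘ₗ A.mkQ ∧
        ∃ z' : rowSpan ρ A →ₗ[Λ] rowSpan ρ A,
          z' ∈ mapsThrough (rowSpan ρ B) (rowSpan ρ A) (rowSpan ρ A) ∧
          ∀ x, (z' x : Fin n → W) = matMap ρ c x := by
    intro z hz
    induction hz using AddSubgroup.closure_induction with
    | mem z hz =>
      obtain ⟨i, p, rfl⟩ := hz
      obtain ⟨a, ha⟩ := Module.projective_lifting_property B.mkQ (i ∘ₗ A.mkQ) B.mkQ_surjective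
      obtain ⟨b, hb⟩ := Module.projective_lifting_property A.mkQ (p ∘ₗ B.mkQ) A.mkQ_surjective
      have haA : ∀ x ∈ A, a x ∈ B := fun x hx => by
        have h1 := LinearMap.congr_fun ha x
        have h2 : A.mkQ x = 0 := by simpa using hx
        rw [LinearMap.comp_apply, LinearMap.comp_apply, h2, map_zero] at h1
        simpa using h1
      have hbB : ∀ x ∈ B, b x ∈ A := fun x hx => by
        have h1 := LinearMap.congr_fun hb x
        have h2 : B.mkQ x = 0 := by simpa using hx
        rw [LinearMap.comp_apply, LinearMap.comp_apply, h2, map_zero] at h1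
        simpa using h1
      refine ⟨b ∘ₗ a, ?_, (matMap ρ b).restrict (fun x hx => matMap_mem_rowSpan hρ hbB hx) ∘ₗ
        (matMap ρ a).restrict (fun x hx => matMap_mem_rowSpan hρ haA hx),
        comp_mem_mapsThrough _ _, fun x => ?_⟩
      · rw [← LinearMap.comp_assoc, hb, LinearMap.comp_assoc, ha, LinearMap.comp_assoc]
      · rw [matMap_comp hρ]
        rfl
    | zero => exact ⟨0, by simp, 0, zero_mem _, by simp⟩
    | add x y _ _ hx hy =>
      obtain ⟨c, hc, z, hz, hzc⟩ := hx
      obtain ⟨c', hc', z', hz', hzc'⟩ := hy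
      exact ⟨c + c', by rw [LinearMap.comp_add, hc, hc', LinearMap.add_comp], z + z',
        add_mem hz hz', fun x => by simp [hzc, hzc']⟩
    | neg x _ hx =>
      obtain ⟨c, hc, z, hz, hzc⟩ := hx
      exact ⟨-c, by rw [LinearMap.comp_neg, hc, LinearMap.neg_comp], -z,
        neg_mem hz, fun x => by simp [hzc]⟩
  obtain ⟨c, hc, z, hz, hzc⟩ := key _ (inAdd_iff.1 h)
  have hcA : ∀ x, (c - LinearMap.id : (Fin n → Λ) →ₗ[Λ] (Fin n → Λ)) x ∈ A := fun x => by
    have := LinearMap.congr_fun hc x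
    rw [← Submodule.Quotient.mk_eq_zero, LinearMap.sub_apply, Submodule.Quotient.mk_sub,
      sub_eq_zero]
    exact this
  let u : (Fin n → W) →ₗ[Λ] rowSpan ρ A := (matMap ρ (c - LinearMap.id)).codRestrict _
    fun w => by
      rw [matMap_apply]
      exact sum_mem fun i _ => rowMap_mem_rowSpan (hcA _) _
  have hid : (LinearMap.id : rowSpan ρ A →ₗ[Λ] rowSpan ρ A) =
      z - u ∘ₗ (rowSpan ρ A).subtype := by
    refine LinearMap.ext fun x => Subtype.ext ?_
    have hu : ((u x : rowSpan ρ A) : Fin n → W) = matMap ρ c x - x := by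
      change matMap ρ (c - LinearMap.id) x = _
      rw [map_sub, matMap_id hρ]
      rfl
    simp [hzc, hu]
  rw [inAdd_iff, hid]
  exact sub_mem (InAdd.fst.mapsThrough_le _ hz)
    ((InAdd.snd.trans (InAdd.pow n)).mem_mapsThrough _ _)

omit hρ in
/-- A divisible submodule of `W ^ n` is the row span of the submodule of `Λ ^ n` of those
elements whose row map takes values in it. -/
theorem eq_rowSpan_of_surjective {n m : ℕ} {X : Submodule Λ (Fin n → W)}
    {f : (Fin m → W) →ₗ[Λ] X} (hf : Function.Surjective f) {A : Submodule Λ (Fin n → Λ)}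
    (hA : ∀ p, p ∈ A ↔ ∀ w, rowMap ρ p w ∈ X) : rowSpan ρ A = X := by
  refine le_antisymm (iSup_le ?_) fun x hx => ?_
  · rintro ⟨p, hp⟩ _ ⟨w, rfl⟩
    exact (hA p).1 hp w
  · obtain ⟨v, hv⟩ := hf ⟨x, hx⟩
    have hx' : x = ∑ j, (X.subtype ∘ₗ f ∘ₗ LinearMap.single Λ (fun _ => W) j) (v j) := by
      simp only [LinearMap.comp_apply, LinearMap.coe_single]
      rw [← map_sum, ← map_sum, Finset.univ_sum_single, hv]
      rfl
    rw [hx']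
    refine sum_mem fun j _ => ?_
    obtain ⟨p, hp⟩ := exists_eq_rowMap ρ
      (X.subtype ∘ₗ f ∘ₗ LinearMap.single Λ (fun _ => W) j)
    rw [hp]
    refine rowMap_mem_rowSpan ((hA p).2 fun w => ?_) _
    rw [← hp]
    exact (f _).2

/-- If the finitely generated torsionless modules form `add T`, then the quotients of powers of
the injective cogenerator `W` form `add L` for a single such quotient `L`. -/
theorem exists_divisible_additive_generator [IsArtinianRing Λ] [IsNoetherianRing Λ]
    (hsep : ∀ (X : Type u) [AddCommGroup X] [Module Λ X] (x : X), x ≠ 0 →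
      ∃ f : X →ₗ[Λ] W, f x ≠ 0)
    (hW : Module.Finite Λ W)
    {T : Type u} [AddCommGroup T] [Module Λ T] (hT : Module.Finite Λ T)
    (hadd : ∀ (N : Type u) [AddCommGroup N] [Module Λ N], Module.Finite Λ N →
      Torsionless Λ N → InAdd Λ T N) :
    ∃ L : ModuleCat.{u} Λ, InAdd Λ L W ∧
      (∃ (n : ℕ) (f : (Fin n → W) →ₗ[Λ] L), Function.Surjective f) ∧
      ∀ (X : Type u) [AddCommGroup X] [Module Λ X] (n : ℕ) (f : (Fin n → W) →ₗ[Λ] X),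
        Function.Surjective f → InAdd Λ L X := by
  obtain ⟨t, π, hπ⟩ := Module.Finite.exists_fin' Λ T
  let B := LinearMap.ker π
  refine ⟨ModuleCat.of Λ (rowSpan ρ B × W), InAdd.snd, ?_, ?_⟩
  · obtain ⟨m, f, hf⟩ := exists_surjective_rowSpan (ρ := ρ) hρ B
    refine ⟨m + 1, (f ∘ₗ LinearMap.pi fun i => LinearMap.proj i.succ).prod
      (LinearMap.proj 0), ?_⟩
    rintro ⟨x, w⟩
    obtain ⟨v, rfl⟩ := hf x
    exact ⟨Fin.cons w v, rfl⟩
  · intro X _ _ m f hf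
    have hX : Module.Finite Λ X := Module.Finite.of_surjective f hf
    obtain ⟨n, j, hj⟩ := exists_embedding_of_separated (Λ := Λ) (M := W) (N := X)
      fun x hx => hsep X x hx
    let e := LinearEquiv.ofInjective j hj
    let Y := LinearMap.range j
    let A : Submodule Λ (Fin n → Λ) :=
      { carrier := {p | ∀ w, rowMap ρ p w ∈ Y}
        zero_mem' := fun w => by simp
        add_mem' := fun {p q} hp hq w => by
          rw [map_add]
          exact add_mem (hp w) (hq w)
        smul_mem' := fun c p hp w => by
          rw [rowMap_smul hρ]
          exact hp _ }
    have hAY : rowSpan ρ A = Y :=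
      eq_rowSpan_of_surjective (f := e.toLinearMap ∘ₗ f) (e.surjective.comp hf) fun p => Iff.rfl
    have htor : Torsionless Λ ((Fin n → Λ) ⧸ A) := by
      refine exists_embedding_of_separated fun x hx => ?_
      obtain ⟨p, rfl⟩ := A.mkQ_surjective x
      have hp : p ∉ A := fun h => hx (by simpa using h)
      obtain ⟨w, hw⟩ : ∃ w, rowMap ρ p w ∉ Y := by
        by_contra hcon
        push Not at hcon
        exact hp hcon
      obtain ⟨c, hc⟩ := hsep _ (Y.mkQ (rowMap ρ p w)) (by simpa using hw)
      let g : (Fin n → Λ) →ₗ[Λ] Λ :=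
        { toFun := fun q => ρ.symm (c ∘ₗ Y.mkQ ∘ₗ rowMap ρ q)
          map_add' := fun q r => by
            rw [← map_add, map_add, LinearMap.comp_add, LinearMap.comp_add]
          map_smul' := fun a q => by
            rw [RingHom.id_apply, smul_eq_mul, AddEquiv.symm_apply_eq, hρ,
              AddEquiv.apply_symm_apply, rowMap_smul hρ]
            rfl }
      have hgA : A ≤ LinearMap.ker g := by
        intro q hq
        change ρ.symm _ = 0
        rw [AddEquiv.symm_apply_eq, map_zero]
        refine LinearMap.ext fun v => ?_
        have : Y.mkQ (rowMap ρ q v) = 0 := by simpa using hq v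
        rw [LinearMap.comp_apply, LinearMap.comp_apply, this, map_zero, LinearMap.zero_apply]
      refine ⟨A.liftQ g hgA, fun h0 => hc ?_⟩
      have h1 : g p = 0 := h0
      have h2 : c ∘ₗ Y.mkQ ∘ₗ rowMap ρ p = 0 := by
        rw [← ρ.apply_symm_apply (c ∘ₗ Y.mkQ ∘ₗ rowMap ρ p)]
        exact (congrArg ρ h1).trans (map_zero ρ)
      exact LinearMap.congr_fun h2 w
    have hTA : InAdd Λ ((Fin t → Λ) ⧸ B) ((Fin n → Λ) ⧸ A) :=
      (InAdd.of_equiv (π.quotKerEquivOfSurjective hπ).symm).trans (hadd _ inferInstance htor)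
    refine (inAdd_rowSpan hρ hTA).trans (.of_equiv (e.trans (LinearEquiv.ofEq _ _ hAY.symm)))

end Divisible

section EndomorphismRing

variable {Λ : Type u} [Ring Λ]
variable {M : Type u} [AddCommGroup M] [Module Λ M]
variable {N : Type u} [AddCommGroup N] [Module Λ N]
variable {X : Type u} [AddCommGroup X] [Module Λ X]

variable (M) in
/-- Precomposition with `c`, as a map of modules over the endomorphism ring of `M`. -/
def precomp (c : X →ₗ[Λ] N) : (N →ₗ[Λ] M) →ₗ[Module.End Λ M] (X →ₗ[Λ] M) where
  toFun f := f ∘ₗ c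
  map_add' _ _ := rfl
  map_smul' _ _ := rfl

theorem precomp_apply (c : X →ₗ[Λ] N) (f : N →ₗ[Λ] M) : precomp M c f = f ∘ₗ c := rfl

theorem eq_sum_comp_single {n : ℕ} (f : (Fin n → M) →ₗ[Λ] N) (v : Fin n → M) :
    f v = ∑ j, f (LinearMap.single Λ (fun _ => M) j (v j)) := by
  simp only [LinearMap.coe_single]
  rw [← map_sum, Finset.univ_sum_single]

variable (Λ M) in
/-- Maps `M ^ n → M` are tuples of endomorphisms of `M`. -/
def powHomEquiv (n : ℕ) :
    ((Fin n → M) →ₗ[Λ] M) ≃ₗ[Module.End Λ M] (Fin n → Module.End Λ M) where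
  toFun f j := f ∘ₗ LinearMap.single Λ (fun _ => M) j
  map_add' _ _ := rfl
  map_smul' _ _ := rfl
  invFun e := ∑ j, e j ∘ₗ LinearMap.proj j
  left_inv f := by
    refine LinearMap.ext fun v => ?_
    rw [eq_sum_comp_single f v]
    simp
  right_inv e := by
    refine funext fun i => LinearMap.ext fun m => ?_
    rw [LinearMap.comp_apply, LinearMap.sum_apply, Finset.sum_eq_single i]
    · simp
    · intro j _ hj
      simp [hj]
    · simp

theorem InAdd.precomp_comp_precomp {n : ℕ} {i : N →ₗ[Λ] (Fin n → M)}
    {p : (Fin n → M) →ₗ[Λ] N} (h : p.comp i = LinearMap.id) :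
    precomp M i ∘ₗ precomp M p = LinearMap.id := by
  refine LinearMap.ext fun f => ?_
  rw [LinearMap.comp_apply, precomp_apply, precomp_apply, LinearMap.comp_assoc, h,
    LinearMap.comp_id, LinearMap.id_apply]

theorem InAdd.projective_hom (h : InAdd Λ M N) :
    Module.Projective (Module.End Λ M) (N →ₗ[Λ] M) := by
  obtain ⟨n, i, p, hip⟩ := h
  have : Module.Projective (Module.End Λ M) ((Fin n → M) →ₗ[Λ] M) :=
    Module.Projective.of_equiv (powHomEquiv Λ M n).symm
  exact Module.Projective.of_split (precomp M p) (precomp M i) (precomp_comp_precomp hip)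

theorem InAdd.finite_hom (h : InAdd Λ M N) :
    Module.Finite (Module.End Λ M) (N →ₗ[Λ] M) := by
  obtain ⟨n, i, p, hip⟩ := h
  have : Module.Finite (Module.End Λ M) ((Fin n → M) →ₗ[Λ] M) :=
    Module.Finite.equiv (powHomEquiv Λ M n).symm
  exact Module.Finite.of_surjective (precomp M i) fun f =>
    ⟨precomp M p f, LinearMap.congr_fun (precomp_comp_precomp hip) f⟩

variable (M) in
/-- The map of powers of `M` attached to a map of free modules over the endomorphism ring. -/
def coMap {a b : ℕ} (h : (Fin a → Module.End Λ M) →ₗ[Module.End Λ M] (Fin b → Module.End Λ M)) :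
    (Fin b → M) →ₗ[Λ] (Fin a → M) :=
  LinearMap.pi fun j => (powHomEquiv Λ M b).symm (h (Pi.single j 1))

theorem map_powHomEquiv {a b : ℕ}
    (h : (Fin a → Module.End Λ M) →ₗ[Module.End Λ M] (Fin b → Module.End Λ M))
    (ψ : (Fin a → M) →ₗ[Λ] M) :
    h (powHomEquiv Λ M a ψ) = powHomEquiv Λ M b (ψ ∘ₗ coMap M h) := by
  rw [← LinearEquiv.symm_apply_eq, pi_eq_sum_univ' (powHomEquiv Λ M a ψ), map_sum, map_sum]
  refine LinearMap.ext fun v => ?_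
  rw [LinearMap.sum_apply, LinearMap.comp_apply, eq_sum_comp_single ψ]
  refine Finset.sum_congr rfl fun j _ => ?_
  rw [map_smul, map_smul]
  rfl

/-- If every finitely generated module has an `add M`-coapproximation with cokernel in `add M`,
then the endomorphism ring of `M` has global dimension at most three. -/
theorem globalDimLE_end [Module.Finite Λ M] [IsNoetherianRing (Module.End Λ M)]
    (h : ∀ (X : Type u) [AddCommGroup X] [Module Λ X], Module.Finite Λ X →
      ∃ (V : ModuleCat.{u} Λ) (c : X →ₗ[Λ] V), InAdd Λ M V ∧
        (∀ f : X →ₗ[Λ] M, ∃ g : V →ₗ[Λ] M, g ∘ₗ c = f) ∧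
        InAdd Λ M (V ⧸ LinearMap.range c)) :
    GlobalDimLE (Module.End Λ M) 3 := by
  intro F hF
  obtain ⟨b, f₀, hf₀⟩ := Module.Finite.exists_fin' (Module.End Λ M) F
  obtain ⟨a, f₁, hf₁⟩ := Module.Finite.exists_fin' (Module.End Λ M) (LinearMap.ker f₀)
  let d := (LinearMap.ker f₀).subtype ∘ₗ f₁
  have hd : ∀ e, f₁ e = 0 ↔ d e = 0 := fun e =>
    (Submodule.coe_eq_zero (p := LinearMap.ker f₀)).symm
  let Y := LinearMap.range (coMap M d)
  obtain ⟨V, c, hV, hext, hcok⟩ := h ((Fin a → M) ⧸ Y) inferInstance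
  let q : (V →ₗ[Λ] M) →ₗ[Module.End Λ M] (Fin a → Module.End Λ M) :=
    (powHomEquiv Λ M a).toLinearMap ∘ₗ precomp M (c ∘ₗ Y.mkQ)
  have hq : ∀ f, f₁ (q f) = 0 := fun f => by
    rw [hd]
    change d (powHomEquiv Λ M a (f ∘ₗ c ∘ₗ Y.mkQ)) = 0
    rw [map_powHomEquiv, LinearEquiv.map_eq_zero_iff]
    refine LinearMap.ext fun v => ?_
    have : Y.mkQ (coMap M d v) = 0 := by simp [Y]
    simp only [LinearMap.comp_apply, this, map_zero, LinearMap.zero_apply]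
  let f₂ : (V →ₗ[Λ] M) →ₗ[Module.End Λ M] LinearMap.ker f₁ := q.codRestrict _ hq
  have hf₂ : Function.Surjective f₂ := by
    rintro ⟨e, he⟩
    obtain ⟨ψ, rfl⟩ := (powHomEquiv Λ M a).surjective e
    have he' := (hd _).1 he
    rw [map_powHomEquiv, LinearEquiv.map_eq_zero_iff] at he'
    have hY : Y ≤ LinearMap.ker ψ := by
      rintro _ ⟨v, rfl⟩
      exact LinearMap.congr_fun he' v
    obtain ⟨g, hg⟩ := hext (Y.liftQ ψ hY)
    refine ⟨g, Subtype.ext ?_⟩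
    change powHomEquiv Λ M a (g ∘ₗ c ∘ₗ Y.mkQ) = _
    rw [← LinearMap.comp_assoc, hg, Submodule.liftQ_mkQ]
  have hker : ∀ f : V →ₗ[Λ] M, f₂ f = 0 ↔ f ∘ₗ c = 0 := fun f => by
    rw [← Submodule.coe_eq_zero]
    change powHomEquiv Λ M a ((f ∘ₗ c) ∘ₗ Y.mkQ) = 0 ↔ _
    rw [LinearEquiv.map_eq_zero_iff]
    refine ⟨fun h0 => ?_, fun h0 => by rw [h0, LinearMap.zero_comp]⟩
    refine LinearMap.ext fun x => ?_
    obtain ⟨v, rfl⟩ := Y.mkQ_surjective x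
    exact LinearMap.congr_fun h0 v
  let f₃ : (V ⧸ LinearMap.range c →ₗ[Λ] M) →ₗ[Module.End Λ M] LinearMap.ker f₂ :=
    (precomp M (LinearMap.range c).mkQ).codRestrict _ fun f => by
      rw [LinearMap.mem_ker, hker, precomp_apply]
      refine LinearMap.ext fun x => ?_
      have : (LinearMap.range c).mkQ (c x) = 0 := by simp
      simp only [LinearMap.comp_apply, this, map_zero, LinearMap.zero_apply]
  have hf₃ : Function.Bijective f₃ := by
    constructor
    · rw [injective_iff_map_eq_zero]
      intro f hf
      refine LinearMap.ext fun x => ?_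
      obtain ⟨v, rfl⟩ := (LinearMap.range c).mkQ_surjective x
      exact LinearMap.congr_fun (congrArg Subtype.val hf) v
    · rintro ⟨f, hf⟩
      have hfc := (hker f).1 hf
      refine ⟨(LinearMap.range c).liftQ f ?_, Subtype.ext (Submodule.liftQ_mkQ _ _ _)⟩
      rintro _ ⟨x, rfl⟩
      exact LinearMap.congr_fun hfc x
  have hP₃ := hcok.projective_hom
  exact ⟨ModuleCat.of _ (Fin b → Module.End Λ M), f₀, inferInstance, inferInstance, hf₀,
    ModuleCat.of _ (Fin a → Module.End Λ M), f₁, inferInstance, inferInstance, hf₁,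
    ModuleCat.of _ (V →ₗ[Λ] M), f₂, hV.projective_hom, hV.finite_hom, hf₂,
    Module.Projective.of_equiv (LinearEquiv.ofBijective f₃ hf₃)⟩

end EndomorphismRing

section ArtinAlgebra

variable (k : Type u) [CommRing k] [IsArtinianRing k]
variable {Λ : Type u} [Ring Λ] [Algebra k Λ] [Module.Finite k Λ]

theorem isNoetherian_hom (X L : Type u) [AddCommGroup X] [Module Λ X] [Module.Finite Λ X]
    [Module k X] [IsScalarTower k Λ X] [AddCommGroup L] [Module Λ L] [Module.Finite Λ L]
    [Module k L] [IsScalarTower k Λ L] : IsNoetherian k (X →ₗ[Λ] L) := by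
  have : Module.Finite k X := Module.Finite.trans Λ X
  have : Module.Finite k L := Module.Finite.trans Λ L
  exact isNoetherian_of_injective (LinearMap.restrictScalarsₗ k Λ X L k)
    (LinearMap.restrictScalars_injective k)

include k in
theorem isNoetherianRing_end (M : Type u) [AddCommGroup M] [Module Λ M] [Module.Finite Λ M] :
    IsNoetherianRing (Module.End Λ M) := by
  let _ := Module.compHom M (algebraMap k Λ)
  have : IsScalarTower k Λ M := .of_algebraMap_smul fun _ _ => rfl
  have : IsNoetherian k (Module.End Λ M) := isNoetherian_hom k M M
  exact isNoetherian_of_tower k this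

include k in
/-- Every finitely generated module has a left approximation by powers of a given finitely
generated module. -/
theorem exists_left_approximation (X L : Type u) [AddCommGroup X] [Module Λ X]
    [Module.Finite Λ X] [AddCommGroup L] [Module Λ L] [Module.Finite Λ L] :
    ∃ (r : ℕ) (v : X →ₗ[Λ] (Fin r → L)),
      ∀ f : X →ₗ[Λ] L, ∃ g : (Fin r → L) →ₗ[Λ] L, g ∘ₗ v = f := by
  let _ := Module.compHom X (algebraMap k Λ)
  have : IsScalarTower k Λ X := .of_algebraMap_smul fun _ _ => rfl
  let _ := Module.compHom L (algebraMap k Λ)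
  have : IsScalarTower k Λ L := .of_algebraMap_smul fun _ _ => rfl
  obtain ⟨r, s, hs⟩ := Submodule.fg_iff_exists_fin_generating_family.1
    ((isNoetherian_hom k (Λ := Λ) X L).noetherian ⊤)
  refine ⟨r, LinearMap.pi s, fun f => ?_⟩
  have hf : f ∈ Submodule.span k (Set.range s) := hs ▸ Submodule.mem_top
  obtain ⟨c, rfl⟩ := (Submodule.mem_span_range_iff_exists_fun k).1 hf
  refine ⟨∑ i, c i • LinearMap.proj i, LinearMap.ext fun x => ?_⟩
  simp

include k in
/-- A pair of finitely generated modules, one generating the torsionless modules and one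
generating the quotients of its own powers, provides approximations whose cokernel is again a
summand. -/
theorem exists_coapproximation [IsArtinianRing Λ] {T L : Type u} [AddCommGroup T] [Module Λ T]
    [AddCommGroup L] [Module Λ L] [Module.Finite Λ L] (hT : Torsionless Λ T)
    (hTadd : ∀ (N : Type u) [AddCommGroup N] [Module Λ N], Module.Finite Λ N →
      Torsionless Λ N → InAdd Λ T N)
    (hLadd : ∀ (N : Type u) [AddCommGroup N] [Module Λ N] (n : ℕ)
      (f : (Fin n → L) →ₗ[Λ] N), Function.Surjective f → InAdd Λ L N)
    (X : Type u) [AddCommGroup X] [Module Λ X] [Module.Finite Λ X] :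
    ∃ (V : ModuleCat.{u} Λ) (c : X →ₗ[Λ] V), InAdd Λ (T × L) V ∧
      (∀ f : X →ₗ[Λ] (T × L), ∃ g : V →ₗ[Λ] (T × L), g ∘ₗ c = f) ∧
      InAdd Λ (T × L) (V ⧸ LinearMap.range c) := by
  let R : Submodule Λ X := ⨅ f : X →ₗ[Λ] Λ, LinearMap.ker f
  have hR : ∀ x, x ∈ R ↔ ∀ f : X →ₗ[Λ] Λ, f x = 0 := fun x => by simp [R]
  have hU : Torsionless Λ (X ⧸ R) := by
    refine exists_embedding_of_separated fun y hy => ?_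
    obtain ⟨x, rfl⟩ := R.mkQ_surjective y
    have hx : x ∉ R := fun h => hy (by simpa using h)
    rw [hR] at hx
    push Not at hx
    obtain ⟨f, hf⟩ := hx
    exact ⟨R.liftQ f (iInf_le _ f), hf⟩
  have hRT : ∀ f : X →ₗ[Λ] T, R ≤ LinearMap.ker f := fun f x hx => by
    by_contra hne
    obtain ⟨g, hg⟩ := hT.exists_ne_zero (x := f x) hne
    exact hg ((hR x).1 hx (g ∘ₗ f))
  obtain ⟨r, v, hv⟩ := exists_left_approximation k (Λ := Λ) X L
  let c : X →ₗ[Λ] (X ⧸ R) × (Fin r → L) := R.mkQ.prod v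
  refine ⟨ModuleCat.of Λ ((X ⧸ R) × (Fin r → L)), c, ?_, fun f => ?_, ?_⟩
  · exact (InAdd.fst.trans (hTadd _ inferInstance hU)).prod (InAdd.snd.trans (InAdd.pow r))
  · obtain ⟨g, hg⟩ := hv (LinearMap.snd Λ T L ∘ₗ f)
    refine ⟨(R.liftQ (LinearMap.fst Λ T L ∘ₗ f) (hRT _)).prodMap g, LinearMap.ext fun x => ?_⟩
    exact Prod.ext rfl (LinearMap.congr_fun hg x)
  · refine InAdd.snd.trans (hLadd _ r ((LinearMap.range c).mkQ ∘ₗ LinearMap.inr Λ _ _) ?_)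
    intro y
    obtain ⟨⟨u, w⟩, rfl⟩ := (LinearMap.range c).mkQ_surjective y
    obtain ⟨x, rfl⟩ := R.mkQ_surjective u
    refine ⟨w - v x, ?_⟩
    rw [LinearMap.comp_apply, ← sub_eq_zero, ← map_sub, Submodule.mkQ_apply,
      Submodule.Quotient.mk_eq_zero]
    exact ⟨-x, by simp [c]⟩

/-- Over an artin algebra, `T × L` is a generator-cogenerator if `add T` contains the finitely
generated torsionless modules and `add L` contains an injective cogenerator `W`. -/
theorem isGenCogen_prod [IsArtinianRing Λ] {T L W : Type u} [AddCommGroup T] [Module Λ T]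
    [Module.Finite Λ T] [AddCommGroup L] [Module Λ L] [Module.Finite Λ L]
    [AddCommGroup W] [Module Λ W]
    (hTadd : ∀ (N : Type u) [AddCommGroup N] [Module Λ N], Module.Finite Λ N →
      Torsionless Λ N → InAdd Λ T N)
    (hsep : ∀ (X : Type u) [AddCommGroup X] [Module Λ X] (x : X), x ≠ 0 →
      ∃ f : X →ₗ[Λ] W, f x ≠ 0) (hLW : InAdd Λ L W) :
    IsGenCogen Λ (T × L) := by
  refine ⟨inferInstance, fun P hP _ => InAdd.fst.trans (hTadd P hP ?_), fun Q hQ hQi => ?_⟩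
  · obtain ⟨n, π, hπ⟩ := Module.Finite.exists_fin' Λ P
    obtain ⟨s, hs⟩ := Module.projective_lifting_property π LinearMap.id hπ
    exact ⟨n, s, Function.LeftInverse.injective (LinearMap.congr_fun hs)⟩
  · obtain ⟨n, j, hj⟩ := exists_embedding_of_separated (Λ := Λ) (M := W) (N := Q)
      fun x hx => hsep Q x hx
    obtain ⟨p, hp⟩ := hQi.out j hj LinearMap.id
    exact (InAdd.snd.trans hLW).trans ⟨n, j, p, LinearMap.ext hp⟩

end ArtinAlgebra

/-- Every torsionless-finite artin algebra has representation dimension at most 3. -/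
theorem stmt3 (k : Type u) [CommRing k] [IsArtinianRing k]
    (Λ : Type u) [Ring Λ] [Algebra k Λ] [Module.Finite k Λ]
    (hTF : TorsionlessFinite Λ) :
    RepDimLE Λ 3 := by
  have : IsArtinianRing Λ := IsArtinianRing.of_finite k Λ
  have : IsNoetherianRing Λ := isNoetherian_of_tower k (inferInstance : IsNoetherian k Λ)
  obtain ⟨W, hW, -, hsep, ρ, hρ⟩ := exists_injective_cogenerator k Λ
  obtain ⟨T, hT, hTT, hTadd⟩ := hTF.exists_additive_generator
  obtain ⟨L, hLW, ⟨n, f, hf⟩, hLadd⟩ :=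
    exists_divisible_additive_generator hρ hsep hW hT hTadd
  have hL : Module.Finite Λ L := Module.Finite.of_surjective f hf
  have := isNoetherianRing_end k (Λ := Λ) (T × L)
  refine ⟨ModuleCat.of Λ (T × L), isGenCogen_prod hTadd hsep hLW,
    globalDimLE_end fun X _ _ _ => exists_coapproximation k hTT hTadd (fun N _ _ m g hg => ?_) X⟩
  let φ : (Fin m × Fin n → W) →ₗ[Λ] (Fin m → L) :=
    LinearMap.pi fun i => f ∘ₗ LinearMap.funLeft Λ W fun j => (i, j)
  have hφ : Function.Surjective φ := fun l => by
    choose w hw using fun i => hf (l i)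
    exact ⟨fun ij => w ij.1 ij.2, funext hw⟩
  exact hLadd N (m * n) (g ∘ₗ φ ∘ₗ (LinearEquiv.funCongrLeft Λ W finProdFinEquiv).toLinearMap)
    (hg.comp (hφ.comp (LinearEquiv.surjective _)))
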